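/- Let λ > −1, ν > −1 be real with λ + ν > −1, and let v > 0 be real. Then the series below converges absolutely and G⁵_λ(cosh v)·G⁵_ν(cosh v) = Σ_{k=0}^∞ [ (k+1)·(λ+k+1)·(ν+k+1)·(λ+ν+k+1) / (2π²·(λ+ν+2k+1)·(λ+ν+2k+3)) ] · G⁵_{λ+ν+2k+2}(cosh v), where G⁵_μ(cosh v) = ( (μ+1)·e^(−(μ−1)v) − (μ−1)·e^(−(μ+1)v) ) / (16·π²·sinh³ v). -/

import Mathlib

open Real

/-- The Euclidean AdS₅ Klein–Gordon propagator with mass parameter `μ`, in the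
hyperbolic-angle variable `v`. -/
noncomputable def G5 (μ v : ℝ) : ℝ :=
  ((μ + 1) * Real.exp (-(μ - 1) * v) - (μ - 1) * Real.exp (-(μ + 1) * v)) /
    (16 * Real.pi ^ 2 * Real.sinh v ^ 3)

open Filter Topology in
theorem tendsto_quartic_mul_pow_zero {x : ℝ} (hx : |x| < 1) (a b c d e : ℝ) :
    Tendsto (fun n : ℕ =>
      (a * (n : ℝ) ^ 4 + b * (n : ℝ) ^ 3 + c * (n : ℝ) ^ 2 + d * (n : ℝ) + e) * x ^ n)
      atTop (𝓝 0) := by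
  have h (j : ℕ) := tendsto_pow_const_mul_const_pow_of_abs_lt_one j hx
  have H := ((((h 4).const_mul a).add ((h 3).const_mul b)).add ((h 2).const_mul c)).add
    (((h 1).const_mul d).add ((h 0).const_mul e))
  simp only [mul_zero, add_zero] at H
  exact H.congr fun n => by ring

/-- The tail of the Källén–Lehmann series in the variable `x = exp (-2 v)`, with the common factor
`exp (-(lam + nu + 1) v)` removed. -/
noncomputable def seriesTail (lam nu x : ℝ) (k : ℕ) : ℝ :=
  ((2 * (k : ℝ) ^ 2 + 2 * (lam + nu + 1) * k + (lam + 1) * (nu + 1)) / (1 - x) +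
    (4 * k + 2 * (lam + nu) + 4) * x / (1 - x) ^ 2 + 4 * x ^ 2 / (1 - x) ^ 3) * x ^ k +
  k * (lam + k) * (nu + k) * (lam + nu + k) / (lam + nu + 2 * k + 1) * x ^ k

theorem seriesTail_sub_succ {lam nu x : ℝ} (hsum : -1 < lam + nu) (hx : x < 1) (k : ℕ) :
    seriesTail lam nu x k - seriesTail lam nu x (k + 1) =
      ((k : ℝ) + 1) * (lam + k + 1) * (nu + k + 1) * (lam + nu + k + 1) *
        (1 / (lam + nu + 2 * k + 1) - x / (lam + nu + 2 * k + 3)) * x ^ k := by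
  have h1 : 1 - x ≠ 0 := by linarith
  have hk : (0 : ℝ) ≤ k := k.cast_nonneg
  have h2 : lam + nu + 2 * (k : ℝ) + 1 ≠ 0 := by linarith
  have h3 : lam + nu + 2 * (k : ℝ) + 3 ≠ 0 := by linarith
  have h4 : lam + nu + 2 * ((k : ℝ) + 1) + 1 = lam + nu + 2 * (k : ℝ) + 3 := by ring
  unfold seriesTail
  push_cast
  rw [h4, pow_succ]
  field_simp
  ring

open Filter Topology in
theorem tendsto_seriesTail {lam nu x : ℝ} (hsum : -1 < lam + nu) (hx : |x| < 1) :
    Tendsto (seriesTail lam nu x) atTop (𝓝 0) := by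
  have hA := tendsto_quartic_mul_pow_zero hx 0 0 (2 / (1 - x))
    (2 * (lam + nu + 1) / (1 - x) + 4 * x / (1 - x) ^ 2)
    ((lam + 1) * (nu + 1) / (1 - x) + (2 * (lam + nu) + 4) * x / (1 - x) ^ 2
      + 4 * x ^ 2 / (1 - x) ^ 3)
  have hB := tendsto_quartic_mul_pow_zero hx 1 (2 * (lam + nu))
    ((lam + nu) ^ 2 + lam * nu) (lam * nu * (lam + nu)) 0
  have hC : Tendsto (fun k : ℕ => (lam + nu + 2 * (k : ℝ) + 1)⁻¹) atTop (𝓝 0) := by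
    refine tendsto_inv_atTop_zero.comp (tendsto_atTop_mono (f := fun k : ℕ => (k : ℝ)) ?_
      tendsto_natCast_atTop_atTop)
    intro k
    have hk : (0 : ℝ) ≤ k := k.cast_nonneg
    linarith
  have H := hA.add (hB.mul hC)
  simp only [mul_zero, add_zero] at H
  refine H.congr fun k => ?_
  unfold seriesTail
  ring

open Filter Topology in
theorem hasSum_of_nonneg_of_sub_succ {f R : ℕ → ℝ} (hf : ∀ k, 0 ≤ f k)
    (hR : ∀ k, f k = R k - R (k + 1)) (hlim : Tendsto R atTop (𝓝 0)) : HasSum f (R 0) := by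
  rw [hasSum_iff_tendsto_nat_of_nonneg hf]
  simp only [hR, Finset.sum_range_sub']
  simpa using hlim.const_sub (R 0)

theorem sinh_eq_exp_mul (v : ℝ) : sinh v = exp v * (1 - exp (-2 * v)) / 2 := by
  have : exp (-v) = exp v * exp (-2 * v) := by rw [← exp_add]; ring_nf
  rw [Real.sinh_eq, this]
  ring

theorem G5_eq (mu v : ℝ) :
    G5 mu v = exp (-(mu - 1) * v) * ((mu + 1) - (mu - 1) * exp (-2 * v)) /
      (16 * π ^ 2 * sinh v ^ 3) := by
  have : exp (-(mu + 1) * v) = exp (-(mu - 1) * v) * exp (-2 * v) := by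
    rw [← exp_add]; ring_nf
  rw [G5, this]
  ring

theorem G5_mul_G5 {lam nu v : ℝ} (hv : 0 < v) :
    G5 lam v * G5 nu v = exp (-(lam + nu + 1) * v) / (32 * π ^ 4 * sinh v ^ 3) *
      seriesTail lam nu (exp (-2 * v)) 0 := by
  have hx : 1 - exp (-2 * v) ≠ 0 := by
    have : exp (-2 * v) < 1 := exp_lt_one_iff.2 (by linarith)
    linarith
  have hE : exp (-(lam - 1) * v) * exp (-(nu - 1) * v) =
      exp (-(lam + nu + 1) * v) * exp v ^ 3 := by
    rw [← exp_add, ← exp_nat_mul, ← exp_add]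
    push_cast
    ring_nf
  have hev := (exp_pos v).ne'
  calc G5 lam v * G5 nu v
      = (exp (-(lam - 1) * v) * exp (-(nu - 1) * v)) *
        (((lam + 1) - (lam - 1) * exp (-2 * v)) * ((nu + 1) - (nu - 1) * exp (-2 * v))) /
        (16 * π ^ 2 * sinh v ^ 3) ^ 2 := by
        rw [G5_eq, G5_eq]
        ring
    _ = _ := by
        rw [hE, seriesTail, sinh_eq_exp_mul]
        generalize exp (-2 * v) = x at *
        have hp := pi_ne_zero
        push_cast
        simp only [pow_zero, zero_mul, mul_zero, zero_div, add_zero, zero_add]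
        field_simp
        ring

theorem KL_term_eq {lam nu v : ℝ} (hsum : -1 < lam + nu) (hv : 0 < v) (k : ℕ) :
    ((k : ℝ) + 1) * (lam + (k : ℝ) + 1) * (nu + (k : ℝ) + 1) * (lam + nu + (k : ℝ) + 1) /
        (2 * π ^ 2 * (lam + nu + 2 * (k : ℝ) + 1) * (lam + nu + 2 * (k : ℝ) + 3)) *
      G5 (lam + nu + 2 * (k : ℝ) + 2) v =
    exp (-(lam + nu + 1) * v) / (32 * π ^ 4 * sinh v ^ 3) *
      (((k : ℝ) + 1) * (lam + k + 1) * (nu + k + 1) * (lam + nu + k + 1) *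
        (1 / (lam + nu + 2 * k + 1) - exp (-2 * v) / (lam + nu + 2 * k + 3)) *
        exp (-2 * v) ^ k) := by
  have hk : (0 : ℝ) ≤ k := k.cast_nonneg
  have h2 : lam + nu + 2 * (k : ℝ) + 1 ≠ 0 := by linarith
  have h3 : lam + nu + 2 * (k : ℝ) + 3 ≠ 0 := by linarith
  have hE : exp (-(lam + nu + 2 * (k : ℝ) + 2 - 1) * v) =
      exp (-(lam + nu + 1) * v) * exp (-2 * v) ^ k := by
    rw [← exp_nat_mul, ← exp_add]
    ring_nf
  have hs := (sinh_pos_iff.2 hv).ne'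
  have hp := pi_ne_zero
  rw [G5_eq, hE, show lam + nu + 2 * (k : ℝ) + 2 + 1 = lam + nu + 2 * k + 3 by ring,
    show lam + nu + 2 * (k : ℝ) + 2 - 1 = lam + nu + 2 * k + 1 by ring]
  generalize lam + nu + 2 * (k : ℝ) + 1 = a at h2 ⊢
  generalize lam + nu + 2 * (k : ℝ) + 3 = b at h3 ⊢
  field_simp
  ring

/-- Källén–Lehmann expansion of the AdS₅ bubble with two independent masses. -/
theorem KL_expansion_AdS5 (lam nu v : ℝ) (hlam : -1 < lam) (hnu : -1 < nu)
    (hsum : -1 < lam + nu) (hv : 0 < v) :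
    Summable (fun k : ℕ =>
      |((k : ℝ) + 1) * (lam + (k : ℝ) + 1) * (nu + (k : ℝ) + 1) * (lam + nu + (k : ℝ) + 1) /
          (2 * Real.pi ^ 2 * (lam + nu + 2 * (k : ℝ) + 1) * (lam + nu + 2 * (k : ℝ) + 3)) *
        G5 (lam + nu + 2 * (k : ℝ) + 2) v|) ∧
    G5 lam v * G5 nu v =
      ∑' k : ℕ,
        ((k : ℝ) + 1) * (lam + (k : ℝ) + 1) * (nu + (k : ℝ) + 1) * (lam + nu + (k : ℝ) + 1) /
            (2 * Real.pi ^ 2 * (lam + nu + 2 * (k : ℝ) + 1) * (lam + nu + 2 * (k : ℝ) + 3)) *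
          G5 (lam + nu + 2 * (k : ℝ) + 2) v := by
  set C := exp (-(lam + nu + 1) * v) / (32 * π ^ 4 * sinh v ^ 3) with hC
  set x := exp (-2 * v) with hx
  have hC0 : 0 ≤ C := by
    have := sinh_pos_iff.2 hv
    positivity
  have hx0 : 0 < x := exp_pos _
  have hx1 : x < 1 := exp_lt_one_iff.2 (by linarith)
  have hnonneg (k : ℕ) : 0 ≤ ((k : ℝ) + 1) * (lam + k + 1) * (nu + k + 1) * (lam + nu + k + 1) *
      (1 / (lam + nu + 2 * k + 1) - x / (lam + nu + 2 * k + 3)) * x ^ k := by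
    have hk : (0 : ℝ) ≤ k := k.cast_nonneg
    have h1 : 0 < lam + k + 1 := by linarith
    have h2 : 0 < nu + k + 1 := by linarith
    have h3 : 0 < lam + nu + k + 1 := by linarith
    have h4 : 0 ≤ 1 / (lam + nu + 2 * k + 1) - x / (lam + nu + 2 * k + 3) := by
      rw [sub_nonneg]
      apply div_le_div₀ <;> linarith
    positivity
  have hsumTail := hasSum_of_nonneg_of_sub_succ hnonneg
    (fun k => (seriesTail_sub_succ hsum hx1 k).symm)
    (tendsto_seriesTail hsum (abs_lt.2 ⟨by linarith, hx1⟩))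
  have hKL := hsumTail.mul_left C
  simp only [KL_term_eq hsum hv, G5_mul_G5 hv, ← hC, ← hx]
  refine ⟨?_, hKL.tsum_eq.symm⟩
  simpa only [abs_of_nonneg (mul_nonneg hC0 (hnonneg _))] using hKL.summable
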